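/- arXiv:2406.02493 — 2 statements merged into one kernel-verified Lean document; each statement's English description precedes it below -/
import Mathlib

section
/- Let F = F̆(α_1,…,α_t) be a fence. Then the set B_I(F) = ∪_{i=1}^{t} ∪_{j=1}^{β_i} {α_i·χ̂_{(i,j)} − j·χ̂_p − (α_i − j)·χ̂_v : p the peak of S_i, v the valley of S_i} (with the convention that χ̂ of a nonexistent peak or valley is the zero function) is a basis of the order ideal toggleability space I_T(F); in particular dim I_T(F) = Σ_{i=1}^{t} (α_i − 1). -/
open scoped Classical

namespace Fence

/-- partial sums: `m α i = α 0 + ⋯ + α (i-1)` (the paper's `m_i`). -/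
def m (α : ℕ → ℕ) (i : ℕ) : ℕ := ∑ k ∈ Finset.range i, α k

/-- the number `n` of elements of the fence `F̆(α)`. -/
def nn (t : ℕ) (α : ℕ → ℕ) : ℕ := m α t - 1

/-- vertex type: index `0` is a dummy (used as sentinel for nonexistent elements);
the fence elements are the indices `1,…,nn t α`. -/
abbrev V (t : ℕ) (α : ℕ → ℕ) := Fin (nn t α + 1)

/-- the element `x_j` (1-based). -/
def xel (t : ℕ) (α : ℕ → ℕ) (j : ℕ) : V t α :=
  ⟨j % (nn t α + 1), Nat.mod_lt _ (Nat.succ_pos _)⟩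

/-- `p` is an actual element of the fence (not the dummy `0`). -/
def Elem (t : ℕ) (α : ℕ → ℕ) (p : V t α) : Prop := 1 ≤ (p : ℕ)

/-- the conditions on `(t, α)` for `F̆(α)` to be a fence. -/
def IsFence (t : ℕ) (α : ℕ → ℕ) : Prop :=
  2 ≤ t ∧ (∀ i < t, 1 ≤ α i) ∧ 2 ≤ α 0 ∧ 2 ≤ α (t - 1)

/-- the covering relation of the fence: `Cov t α a b` means `a ⋖ b`. -/
def Cov (t : ℕ) (α : ℕ → ℕ) (a b : V t α) : Prop :=
  ∃ i < t, ((i % 2 = 0 ∧ (b : ℕ) = (a : ℕ) + 1) ∨ (i % 2 = 1 ∧ (a : ℕ) = (b : ℕ) + 1)) ∧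
    m α i ≤ min (a : ℕ) (b : ℕ) ∧ min (a : ℕ) (b : ℕ) < m α (i + 1) ∧
    1 ≤ min (a : ℕ) (b : ℕ) ∧ max (a : ℕ) (b : ℕ) ≤ nn t α

/-- the order of the fence: reflexive–transitive closure of the covering relation. -/
def Le (t : ℕ) (α : ℕ → ℕ) : V t α → V t α → Prop := Relation.ReflTransGen (Cov t α)

/-- order ideals of the fence (as sets of actual elements, downward closed). -/
def IsIdeal (t : ℕ) (α : ℕ → ℕ) (I : Set (V t α)) : Prop :=
  (∀ p ∈ I, Elem t α p) ∧ ∀ a b : V t α, Le t α a b → b ∈ I → a ∈ I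

/-- `J t α` is the set of order ideals of the fence. -/
abbrev J (t : ℕ) (α : ℕ → ℕ) := {I : Set (V t α) // IsIdeal t α I}

/-- `p` is a maximal element of the set `I`. -/
def MaxIn (t : ℕ) (α : ℕ → ℕ) (I : Set (V t α)) (p : V t α) : Prop :=
  p ∈ I ∧ ∀ q ∈ I, Le t α p q → q = p

/-- `p` is a minimal element of the complement of `I` (among actual elements). -/
def MinOut (t : ℕ) (α : ℕ → ℕ) (I : Set (V t α)) (p : V t α) : Prop :=
  Elem t α p ∧ p ∉ I ∧ ∀ q : V t α, Elem t α q → q ∉ I → Le t α q p → q = p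

/-- the order-ideal indicator function `χ̂_p`. -/
noncomputable def chiHat (t : ℕ) (α : ℕ → ℕ) (p : V t α) (I : J t α) : ℝ :=
  if p ∈ I.1 then 1 else 0

/-- the antichain indicator function `χ_p`. -/
noncomputable def chi (t : ℕ) (α : ℕ → ℕ) (p : V t α) (I : J t α) : ℝ :=
  if MaxIn t α I.1 p then 1 else 0

/-- the toggleability statistic `T_p`. -/
noncomputable def Tg (t : ℕ) (α : ℕ → ℕ) (p : V t α) (I : J t α) : ℝ :=
  if MinOut t α I.1 p then 1 else if MaxIn t α I.1 p then -1 else 0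

/-- the antichain toggleability statistic `T_A`. -/
noncomputable def TA (t : ℕ) (α : ℕ → ℕ) (A : Set (V t α)) (I : J t α) : ℝ :=
  if ∀ p ∈ A, MinOut t α I.1 p then 1 else if ∀ p ∈ A, MaxIn t α I.1 p then -1 else 0

/-- `#[a,b]`: the number of elements `r` with `a ⊴ r ⊴ b`. -/
noncomputable def icard (t : ℕ) (α : ℕ → ℕ) (a b : V t α) : ℕ :=
  Set.ncard {r : V t α | Elem t α r ∧ Le t α a r ∧ Le t α r b}

/-- the span of the toggleability statistics `{T_p : p ∈ F}`. -/
noncomputable def ToggSpan (t : ℕ) (α : ℕ → ℕ) : Submodule ℝ (J t α → ℝ) :=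
  Submodule.span ℝ {f | ∃ p : V t α, Elem t α p ∧ f = Tg t α p}

/-- `f ≡ g`: `f - g` is an `ℝ`-linear combination of toggleability statistics. -/
def Equiv' (t : ℕ) (α : ℕ → ℕ) (f g : J t α → ℝ) : Prop := f - g ∈ ToggSpan t α

/-- statistics of the form `const + linear combination of toggleability statistics`. -/
noncomputable def ConstPlusTogg (t : ℕ) (α : ℕ → ℕ) : Submodule ℝ (J t α → ℝ) :=
  ToggSpan t α ⊔ Submodule.span ℝ {fun _ : J t α => (1 : ℝ)}

/-- the span of the antichain indicator functions `{χ_p : p ∈ F}`. -/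
noncomputable def chiSpan (t : ℕ) (α : ℕ → ℕ) : Submodule ℝ (J t α → ℝ) :=
  Submodule.span ℝ {f | ∃ p : V t α, Elem t α p ∧ f = chi t α p}

/-- the span of the order-ideal indicator functions `{χ̂_p : p ∈ F}`. -/
noncomputable def chiHatSpan (t : ℕ) (α : ℕ → ℕ) : Submodule ℝ (J t α → ℝ) :=
  Submodule.span ℝ {f | ∃ p : V t α, Elem t α p ∧ f = chiHat t α p}

/-- the antichain toggleability space `A_T(F)`. -/
noncomputable def AT (t : ℕ) (α : ℕ → ℕ) : Submodule ℝ (J t α → ℝ) :=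
  chiSpan t α ⊓ ConstPlusTogg t α

/-- the order ideal toggleability space `I_T(F)`. -/
noncomputable def IT (t : ℕ) (α : ℕ → ℕ) : Submodule ℝ (J t α → ℝ) :=
  chiHatSpan t α ⊓ ConstPlusTogg t α

/-- the shared element `s_i = x_{m_i}` (for `1 ≤ i ≤ t-1`); the sentinels `i = 0` and
`i = t` give the dummy vertex `0`, so statistics indexed by them vanish. -/
def sElx (t : ℕ) (α : ℕ → ℕ) (i : ℕ) : V t α := xel t α (m α i)

/-- 1-based index of the unshared element `s_{(i,j)}` (the `j`-th smallest unshared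
element of the segment `S_i`, in the order of the fence). -/
def uEl (α : ℕ → ℕ) (i j : ℕ) : ℕ :=
  if (i - 1) % 2 = 0 then m α (i - 1) + j else m α i - j

def uElx (t : ℕ) (α : ℕ → ℕ) (i j : ℕ) : V t α := xel t α (uEl α i j)

/-- 1-based index of the peak of segment `S_i` (sentinel `0` if it does not exist). -/
def peakN (t : ℕ) (α : ℕ → ℕ) (i : ℕ) : ℕ :=
  if i % 2 = 1 then (if i + 1 ≤ t then m α i else 0) else m α (i - 1)

/-- 1-based index of the valley of segment `S_i` (sentinel `0` if it does not exist). -/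
def valleyN (t : ℕ) (α : ℕ → ℕ) (i : ℕ) : ℕ :=
  if i % 2 = 1 then (if 2 ≤ i then m α (i - 1) else 0) else (if i + 1 ≤ t then m α i else 0)

def peakx (t : ℕ) (α : ℕ → ℕ) (i : ℕ) : V t α := xel t α (peakN t α i)
def valleyx (t : ℕ) (α : ℕ → ℕ) (i : ℕ) : V t α := xel t α (valleyN t α i)

/-- segment `S_i` has a peak. -/
def HasPeak (t i : ℕ) : Prop := i % 2 = 0 ∨ i + 1 ≤ t

/-- segment `S_i` has a valley. -/
def HasValley (t i : ℕ) : Prop := (i % 2 = 1 ∧ 2 ≤ i) ∨ (i % 2 = 0 ∧ i + 1 ≤ t)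

/-- `p` is a shared element of the fence. -/
def IsSharedElem (t : ℕ) (α : ℕ → ℕ) (p : V t α) : Prop :=
  ∃ i, 1 ≤ i ∧ i + 1 ≤ t ∧ p = sElx t α i

/-- `p` is a peak of the fence. -/
def IsPeakElem (t : ℕ) (α : ℕ → ℕ) (p : V t α) : Prop :=
  ∃ i, 1 ≤ i ∧ i + 1 ≤ t ∧ i % 2 = 1 ∧ p = sElx t α i

/-- span of the antichain indicators of the shared elements. -/
noncomputable def chiSharedSpan (t : ℕ) (α : ℕ → ℕ) : Submodule ℝ (J t α → ℝ) :=
  Submodule.span ℝ {f | ∃ i, 1 ≤ i ∧ i + 1 ≤ t ∧ f = chi t α (sElx t α i)}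

/-- span of the order-ideal indicators of the shared elements. -/
noncomputable def chiHatSharedSpan (t : ℕ) (α : ℕ → ℕ) : Submodule ℝ (J t α → ℝ) :=
  Submodule.span ℝ {f | ∃ i, 1 ≤ i ∧ i + 1 ≤ t ∧ f = chiHat t α (sElx t α i)}

theorem cov_elem {t : ℕ} {α : ℕ → ℕ} {a b : V t α} (h : Cov t α a b) :
    Elem t α a ∧ Elem t α b := by
  obtain ⟨i, hi, hd, h1, h2, h3, h4⟩ := h
  constructor <;> (simp only [Elem]; omega)

theorem le_elem {t : ℕ} {α : ℕ → ℕ} {a b : V t α} (h : Le t α a b) (hb : Elem t α b) :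
    Elem t α a := by
  induction h using Relation.ReflTransGen.head_induction_on with
  | refl => exact hb
  | head hc _ _ => exact (cov_elem hc).1

/-- rowmotion: `ρ(I)` is the order ideal generated by the minimal elements of the
complement of `I`. -/
noncomputable def rho (t : ℕ) (α : ℕ → ℕ) (I : J t α) : J t α :=
  ⟨{q | ∃ p : V t α, MinOut t α I.1 p ∧ Le t α q p}, by
    constructor
    · rintro q ⟨p, hp, hle⟩
      exact le_elem hle hp.1
    · rintro a b hab ⟨p, hp, hle⟩
      exact ⟨p, hp, Relation.ReflTransGen.trans hab hle⟩⟩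

/-- the (forward) orbit of `x` under `ρ`. -/
def orbit {X : Type*} (ρ : X → X) (x : X) : Set X := {y | ∃ k : ℕ, ρ^[k] x = y}

/-- `f` is `c`-mesic under `ρ`: the sum of `f` over each orbit is `c` times
the orbit size. -/
def IsMesic {X : Type*} (ρ : X → X) (f : X → ℝ) (c : ℝ) : Prop :=
  ∀ x : X, ∑ᶠ y ∈ orbit ρ x, f y = (orbit ρ x).ncard * c


/-- The set `B_I(F) = ⋃_{i=1}^t ⋃_{j=1}^{β_i} {α_i·χ̂_{(i,j)} − j·χ̂_p − (α_i−j)·χ̂_v}`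
(with `χ̂` of a nonexistent peak/valley the zero function, via the sentinel). -/
noncomputable def BI (t : ℕ) (α : ℕ → ℕ) : Set (J t α → ℝ) :=
  {f | ∃ i j, 1 ≤ i ∧ i ≤ t ∧ 1 ≤ j ∧ j ≤ α (i - 1) - 1 ∧
    f = fun I => (α (i - 1) : ℝ) * chiHat t α (uElx t α i j) I
          - (j : ℝ) * chiHat t α (peakx t α i) I
          - ((α (i - 1) : ℝ) - (j : ℝ)) * chiHat t α (valleyx t α i) I}


/-- step `j → j+1` goes up -/
def U (t : ℕ) (α : ℕ → ℕ) (j : ℕ) : Prop := ∃ i < t, i % 2 = 0 ∧ m α i ≤ j ∧ j < m α (i + 1)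
/-- step `j → j+1` goes down -/
def D (t : ℕ) (α : ℕ → ℕ) (j : ℕ) : Prop := ∃ i < t, i % 2 = 1 ∧ m α i ≤ j ∧ j < m α (i + 1)

theorem m_succ (α : ℕ → ℕ) (i : ℕ) : m α (i + 1) = m α i + α i := by
  simp [m, Finset.sum_range_succ]

theorem m_zero (α : ℕ → ℕ) : m α 0 = 0 := by simp [m]

theorem m_mono (α : ℕ → ℕ) : Monotone (m α) :=
  monotone_nat_of_le_succ fun i => by rw [m_succ]; omega

theorem exists_seg (t : ℕ) (α : ℕ → ℕ) (j : ℕ) (h : j < m α t) :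
    ∃ i < t, m α i ≤ j ∧ j < m α (i + 1) := by
  induction t with
  | zero => simp [m_zero] at h
  | succ t ih =>
    by_cases hj : j < m α t
    · obtain ⟨i, hi, h1⟩ := ih hj
      exact ⟨i, by omega, h1⟩
    · exact ⟨t, by omega, by omega, h⟩

theorem seg_unique (α : ℕ → ℕ) {j i i' : ℕ} (h1 : m α i ≤ j) (h2 : j < m α (i + 1))
    (h3 : m α i' ≤ j) (h4 : j < m α (i' + 1)) : i = i' := by
  rcases lt_trichotomy i i' with h | h | h
  · have := m_mono α (show i + 1 ≤ i' from h); omega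
  · exact h
  · have := m_mono α (show i' + 1 ≤ i from h); omega

theorem not_UD {t : ℕ} {α : ℕ → ℕ} {j : ℕ} (h1 : U t α j) (h2 : D t α j) : False := by
  obtain ⟨i, _, hi, h3, h4⟩ := h1
  obtain ⟨i', _, hi', h5, h6⟩ := h2
  have := seg_unique α h3 h4 h5 h6
  omega

theorem U_or_D {t : ℕ} {α : ℕ → ℕ} {j : ℕ} (h : j < m α t) : U t α j ∨ D t α j := by
  obtain ⟨i, hi, h1, h2⟩ := exists_seg t α j h
  rcases Nat.mod_two_eq_zero_or_one i with h3 | h3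
  · exact Or.inl ⟨i, hi, h3, h1, h2⟩
  · exact Or.inr ⟨i, hi, h3, h1, h2⟩

theorem cov_iff {t : ℕ} {α : ℕ → ℕ} {a b : V t α} : Cov t α a b ↔
    ((b : ℕ) = a + 1 ∧ 1 ≤ (a : ℕ) ∧ U t α a) ∨ ((a : ℕ) = b + 1 ∧ 1 ≤ (b : ℕ) ∧ D t α b) := by
  have ha := a.2
  have hb := b.2
  constructor
  · rintro ⟨i, hi, h | h, h1, h2, h3, h4⟩
    · exact Or.inl ⟨h.2, by omega, i, hi, h.1, by omega, by omega⟩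
    · exact Or.inr ⟨h.2, by omega, i, hi, h.1, by omega, by omega⟩
  · rintro (⟨h1, h2, i, hi, h3, h4, h5⟩ | ⟨h1, h2, i, hi, h3, h4, h5⟩)
    · exact ⟨i, hi, Or.inl ⟨h3, h1⟩, by omega, by omega, by omega, by omega⟩
    · exact ⟨i, hi, Or.inr ⟨h3, h1⟩, by omega, by omega, by omega, by omega⟩

theorem le_dir {t : ℕ} {α : ℕ → ℕ} {p q : V t α} (h : Le t α p q) :
    ∀ j : ℕ, ((p : ℕ) ≤ j → j < q → U t α j) ∧ ((q : ℕ) ≤ j → j < p → D t α j) := by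
  induction h with
  | refl => intro j; constructor <;> intros <;> omega
  | @tail q r _ hc ih =>
    intro j
    rcases cov_iff.1 hc with ⟨h1, h2, h3⟩ | ⟨h1, h2, h3⟩
    · constructor
      · intro h4 h5
        by_cases hj : j = q
        · rw [hj]; exact h3
        · exact (ih j).1 h4 (by omega)
      · intro h4 h5
        exact (ih j).2 (by omega) h5
    · constructor
      · intro h4 h5
        exact (ih j).1 h4 (by omega)
      · intro h4 h5
        by_cases hj : j = r
        · rw [hj]; exact h3
        · exact (ih j).2 (by omega) h5

theorem le_antisymm' {t : ℕ} {α : ℕ → ℕ} {p q : V t α} (h : Le t α p q) (h' : Le t α q p) :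
    p = q := by
  rcases lt_trichotomy (p : ℕ) q with h1 | h1 | h1
  · exact (not_UD ((le_dir h p).1 le_rfl h1) ((le_dir h' p).2 le_rfl h1)).elim
  · exact Fin.ext h1
  · exact (not_UD ((le_dir h' q).1 le_rfl h1) ((le_dir h q).2 le_rfl h1)).elim

/-- extended membership -/
def Mem (t : ℕ) (α : ℕ → ℕ) (j : ℕ) (I : J t α) : Prop :=
  if j = 0 then True else if j ≤ nn t α then xel t α j ∈ I.1 else D t α (nn t α)

noncomputable def E (t : ℕ) (α : ℕ → ℕ) (j : ℕ) (I : J t α) : ℝ := if Mem t α j I then 1 else 0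

theorem xel_val {t : ℕ} {α : ℕ → ℕ} {j : ℕ} (h : j ≤ nn t α) : (xel t α j : ℕ) = j := by
  simp only [xel]; exact Nat.mod_eq_of_lt (by omega)

theorem xel_self {t : ℕ} {α : ℕ → ℕ} (p : V t α) : xel t α (p : ℕ) = p :=
  Fin.ext (xel_val (by have := p.2; omega))

theorem mem_mid {t : ℕ} {α : ℕ → ℕ} {j : ℕ} (I : J t α) (h0 : 1 ≤ j) (h : j ≤ nn t α) :
    Mem t α j I ↔ xel t α j ∈ I.1 := by
  simp [Mem, show j ≠ 0 by omega, h]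

theorem mem_el {t : ℕ} {α : ℕ → ℕ} (p : V t α) (I : J t α) (h0 : 1 ≤ (p : ℕ)) :
    Mem t α p I ↔ p ∈ I.1 := by
  rw [mem_mid I h0 (by have := p.2; omega), xel_self]

theorem minOut_iff {t : ℕ} {α : ℕ → ℕ} {j : ℕ} (I : J t α) (h : j + 1 ≤ nn t α) :
    MinOut t α I.1 (xel t α (j + 1)) ↔
      ¬ Mem t α (j + 1) I ∧ (U t α j → Mem t α j I) ∧ (D t α (j + 1) → Mem t α (j + 2) I) := by
  have hv := xel_val h
  constructor
  · rintro ⟨h1, h2, h3⟩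
    refine ⟨by rwa [mem_mid I (by omega) h], ?_, ?_⟩
    · intro hU
      by_cases hj : j = 0
      · simp [Mem, hj]
      rw [mem_mid I (by omega) (by omega)]
      by_contra hc
      have hw := xel_val (t := t) (α := α) (j := j) (by omega)
      have := h3 (xel t α j) (by simp only [Elem]; omega) hc
        (Relation.ReflTransGen.single (cov_iff.2 (Or.inl (by rw [hw, hv]; exact ⟨rfl, by omega, hU⟩))))
      have := congrArg Fin.val this
      omega
    · intro hD
      by_cases hj : j + 2 ≤ nn t α
      · rw [mem_mid I (by omega) hj]
        by_contra hc
        have hw := xel_val hj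
        have := h3 (xel t α (j+2)) (by simp only [Elem]; omega) hc
          (Relation.ReflTransGen.single (cov_iff.2 (Or.inr (by rw [hw, hv]; exact ⟨rfl, by omega, hD⟩))))
        have := congrArg Fin.val this
        omega
      · have : j + 1 = nn t α := by omega
        rw [this] at hD
        simpa [Mem, hj] using hD
  · rintro ⟨h1, h2, h3⟩
    refine ⟨by simp only [Elem]; omega, by rwa [mem_mid I (by omega) h] at h1, ?_⟩
    intro q hq hqI hle
    rcases Relation.ReflTransGen.cases_tail hle with he | ⟨c, hqc, hc⟩
    · exact he.symm
    exfalso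
    have hcI : c ∉ I.1 := fun hcI => hqI (I.2.2 _ _ hqc hcI)
    have hce := (cov_elem hc).1
    rw [← mem_el c I hce] at hcI
    rcases cov_iff.1 hc with ⟨e1, e2, e3⟩ | ⟨e1, e2, e3⟩
    · rw [hv] at e1
      have : (c : ℕ) = j := by omega
      rw [this] at e3 hcI
      exact hcI (h2 e3)
    · rw [hv] at e1 e3
      rw [e1] at hcI
      exact hcI (h3 e3)

theorem maxIn_iff {t : ℕ} {α : ℕ → ℕ} {j : ℕ} (I : J t α) (h : j + 1 ≤ nn t α)
    (hF : IsFence t α) :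
    MaxIn t α I.1 (xel t α (j + 1)) ↔
      Mem t α (j + 1) I ∧ (D t α j → ¬ Mem t α j I) ∧ (U t α (j + 1) → ¬ Mem t α (j + 2) I) := by
  have hv := xel_val h
  constructor
  · rintro ⟨h1, h2⟩
    refine ⟨by rwa [mem_mid I (by omega) h], ?_, ?_⟩
    · intro hU
      by_cases hj : j = 0
      · exfalso
        obtain ⟨i, hi, e, h4, h5⟩ := hU
        subst hj
        have h6 := m_mono α (show 1 ≤ i by omega)
        have : 0 < m α 1 := by
          have := m_succ α 0
          have := hF.2.2.1
          simp only [zero_add] at *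
          omega
        omega
      rw [mem_mid I (by omega) (by omega)]
      intro hc
      have hw := xel_val (t := t) (α := α) (j := j) (by omega)
      have := h2 (xel t α j) hc
        (Relation.ReflTransGen.single (cov_iff.2 (Or.inr (by rw [hw, hv]; exact ⟨rfl, by omega, hU⟩))))
      have := congrArg Fin.val this
      omega
    · intro hD
      by_cases hj : j + 2 ≤ nn t α
      · rw [mem_mid I (by omega) hj]
        intro hc
        have hw := xel_val hj
        have := h2 (xel t α (j+2)) hc
          (Relation.ReflTransGen.single (cov_iff.2 (Or.inl (by rw [hw, hv]; exact ⟨rfl, by omega, hD⟩))))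
        have := congrArg Fin.val this
        omega
      · have : j + 1 = nn t α := by omega
        rw [this] at hD
        simpa [Mem, hj] using fun h => not_UD hD h
  · rintro ⟨h1, h2, h3⟩
    have h1' := h1
    rw [mem_mid I (by omega) h] at h1'
    refine ⟨h1', ?_⟩
    intro q hqI hle
    rcases Relation.ReflTransGen.cases_head hle with he | ⟨c, hc, hqc⟩
    · exact he.symm
    exfalso
    have hcI : c ∈ I.1 := I.2.2 _ _ hqc hqI
    have hce := (cov_elem hc).2
    rw [← mem_el c I hce] at hcI
    rcases cov_iff.1 hc with ⟨e1, e2, e3⟩ | ⟨e1, e2, e3⟩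
    · rw [hv] at e1 e3
      rw [e1] at hcI
      exact h3 e3 hcI
    · rw [hv] at e1
      have : (c : ℕ) = j := by omega
      rw [this] at e3 hcI
      exact h2 e3 hcI

theorem nn_lt {t : ℕ} {α : ℕ → ℕ} (hF : IsFence t α) : nn t α + 1 = m α t := by
  have h1 := m_mono α (show 1 ≤ t by have := hF.1; omega)
  have h2 := m_succ α 0
  have := hF.2.2.1
  simp only [zero_add, m_zero] at *
  simp only [nn]
  omega

theorem D_zero {t : ℕ} {α : ℕ → ℕ} (hF : IsFence t α) : ¬ D t α 0 := by
  rintro ⟨i, hi, e, h4, h5⟩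
  have h6 := m_mono α (show 1 ≤ i by omega)
  have := m_succ α 0
  have := hF.2.2.1
  simp only [zero_add] at *
  omega

theorem mem_down {t : ℕ} {α : ℕ → ℕ} (I : J t α) {j : ℕ} (hj : j ≤ nn t α)
    (hU : U t α j) (h : Mem t α (j + 1) I) : Mem t α j I := by
  by_cases h0 : j = 0
  · simp [Mem, h0]
  by_cases h1 : j + 1 ≤ nn t α
  · rw [mem_mid I (by omega) h1] at h
    rw [mem_mid I (by omega) hj]
    refine I.2.2 _ _ (Relation.ReflTransGen.single (cov_iff.2 (Or.inl ?_))) h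
    rw [xel_val h1, xel_val hj]
    exact ⟨rfl, by omega, hU⟩
  · have : j = nn t α := by omega
    simp [Mem, h1] at h
    rw [← this] at h
    exact (not_UD hU h).elim

theorem mem_up {t : ℕ} {α : ℕ → ℕ} (hF : IsFence t α) (I : J t α) {j : ℕ} (hj : j ≤ nn t α)
    (hD : D t α j) (h : Mem t α j I) : Mem t α (j + 1) I := by
  by_cases h0 : j = 0
  · rw [h0] at hD
    exact (D_zero hF hD).elim
  by_cases h1 : j + 1 ≤ nn t α
  · rw [mem_mid I (by omega) h1]
    rw [mem_mid I (by omega) hj] at h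
    refine I.2.2 _ _ (Relation.ReflTransGen.single (cov_iff.2 (Or.inr ?_))) h
    rw [xel_val h1, xel_val hj]
    exact ⟨rfl, by omega, hD⟩
  · have : j = nn t α := by omega
    rw [this] at hD
    simpa [Mem, h1] using hD

theorem Tg_lin {t : ℕ} {α : ℕ → ℕ} (hF : IsFence t α) (I : J t α) {j : ℕ} (hj : j + 1 ≤ nn t α)
    (h : (U t α j ∧ U t α (j + 1)) ∨ (D t α j ∧ D t α (j + 1))) :
    Tg t α (xel t α (j + 1)) I = E t α j I - 2 * E t α (j + 1) I + E t α (j + 2) I := by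
  rw [Tg, minOut_iff I hj, maxIn_iff I hj hF]
  simp only [E]
  rcases h with ⟨h1, h2⟩ | ⟨h1, h2⟩
  · have h3 := fun h => not_UD h1 h
    have h4 := fun h => not_UD h2 h
    have h5 := mem_down I (by omega) h1
    have h6 := mem_down I hj h2
    by_cases a : Mem t α j I <;> by_cases b : Mem t α (j + 1) I <;>
      by_cases c : Mem t α (j + 2) I <;> simp_all <;> norm_num
  · have h3 := fun h => not_UD h h1
    have h4 := fun h => not_UD h h2
    have h5 := mem_up hF I (by omega) h1
    have h6 := mem_up hF I hj h2
    by_cases a : Mem t α j I <;> by_cases b : Mem t α (j + 1) I <;>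
      by_cases c : Mem t α (j + 2) I <;> simp_all <;> norm_num

theorem Tg_peak {t : ℕ} {α : ℕ → ℕ} (hF : IsFence t α) (I : J t α) {j : ℕ} (hj : j + 1 ≤ nn t α)
    (h1 : U t α j) (h2 : D t α (j + 1)) :
    Tg t α (xel t α (j + 1)) I = E t α j I * E t α (j + 2) I - 2 * E t α (j + 1) I := by
  rw [Tg, minOut_iff I hj, maxIn_iff I hj hF]
  simp only [E]
  have h3 := fun h => not_UD h1 h
  have h4 := fun h => not_UD h h2
  have h5 := mem_down I (by omega) h1
  have h6 := mem_up hF I hj h2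
  by_cases a : Mem t α j I <;> by_cases b : Mem t α (j + 1) I <;>
    by_cases c : Mem t α (j + 2) I <;> simp_all <;> norm_num

theorem Tg_valley {t : ℕ} {α : ℕ → ℕ} (hF : IsFence t α) (I : J t α) {j : ℕ}
    (hj : j + 1 ≤ nn t α) (h1 : D t α j) (h2 : U t α (j + 1)) :
    Tg t α (xel t α (j + 1)) I =
      1 - 2 * E t α (j + 1) I + E t α j I + E t α (j + 2) I - E t α j I * E t α (j + 2) I := by
  rw [Tg, minOut_iff I hj, maxIn_iff I hj hF]
  simp only [E]
  have h3 := fun h => not_UD h h1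
  have h4 := fun h => not_UD h2 h
  have h5 := mem_up hF I (by omega) h1
  have h6 := mem_down I hj h2
  by_cases a : Mem t α j I <;> by_cases b : Mem t α (j + 1) I <;>
    by_cases c : Mem t α (j + 2) I <;> simp_all <;> norm_num

/-- test ideals -/
def testSet (t : ℕ) (α : ℕ → ℕ) (A S : Set (V t α)) : Set (V t α) :=
  {r | (Elem t α r ∧ ∀ a ∈ A, ¬ Le t α a r) ∨ r ∈ S}

theorem testSet_ideal {t : ℕ} {α : ℕ → ℕ} {A S : Set (V t α)} (hA : ∀ a ∈ A, Elem t α a)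
    (hanti : ∀ a ∈ A, ∀ b ∈ A, Le t α a b → a = b) (hS : S ⊆ A) :
    IsIdeal t α (testSet t α A S) := by
  constructor
  · rintro p (h | h)
    · exact h.1
    · exact hA p (hS h)
  · rintro c d hcd (h | h)
    · exact Or.inl ⟨le_elem hcd h.1, fun a ha hac => h.2 a ha (hac.trans hcd)⟩
    · by_cases hc : c = d
      · exact Or.inr (hc ▸ h)
      · refine Or.inl ⟨le_elem hcd (hA d (hS h)), fun a ha hac => hc ?_⟩
        have := hanti a ha d (hS h) (hac.trans hcd)
        subst this
        exact le_antisymm' hcd hac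

/-- the four (or two) test ideals as elements of `J` (junk `∅` never used). -/
theorem chiHat_test {t : ℕ} {α : ℕ → ℕ} {A S : Set (V t α)} (h : IsIdeal t α (testSet t α A S))
    (h' : IsIdeal t α (testSet t α A ∅)) (hS : S ⊆ A) (r : V t α) :
    chiHat t α r ⟨_, h⟩ = chiHat t α r ⟨_, h'⟩ + if r ∈ S then 1 else 0 := by
  have : r ∈ S → ¬ (Elem t α r ∧ ∀ a ∈ A, ¬ Le t α a r) :=
    fun hr hc => hc.2 r (hS hr) Relation.ReflTransGen.refl
  simp only [chiHat, testSet, Set.mem_ofPred_eq, Set.mem_empty_iff_false, or_false]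
  by_cases h1 : r ∈ S
  · simp [h1, this h1]
  · simp [h1]

theorem E_mid {t : ℕ} {α : ℕ → ℕ} {j : ℕ} (I : J t α) (h0 : 1 ≤ j) (h : j ≤ nn t α) :
    E t α j I = chiHat t α (xel t α j) I := by
  simp only [E, chiHat, mem_mid I h0 h]

theorem E_zero {t : ℕ} {α : ℕ → ℕ} (I : J t α) : E t α 0 I = 1 := by simp [E, Mem]

theorem E_big {t : ℕ} {α : ℕ → ℕ} (I : J t α) {j : ℕ} (h : nn t α < j) :
    E t α j I = if D t α (nn t α) then 1 else 0 := by
  simp [E, Mem, show j ≠ 0 by omega, show ¬ j ≤ nn t α by omega]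

theorem chiHat_dummy {t : ℕ} {α : ℕ → ℕ} {p : V t α} (h : (p : ℕ) = 0) (I : J t α) :
    chiHat t α p I = 0 := by
  have : p ∉ I.1 := fun hp => by have := I.2.1 p hp; simp only [Elem] at this; omega
  simp [chiHat, this]

/-- dual functionals for `χ̂` -/
theorem exists_dual {t : ℕ} {α : ℕ → ℕ} (q : V t α) (hq : Elem t α q) :
    ∃ φ : (J t α → ℝ) →ₗ[ℝ] ℝ, ∀ r, φ (chiHat t α r) = if r = q then 1 else 0 := by
  have hA : ∀ a ∈ ({q} : Set (V t α)), Elem t α a := by rintro a rfl; exact hq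
  have hB : ∀ a ∈ ({q} : Set (V t α)), ∀ b ∈ ({q} : Set (V t α)), Le t α a b → a = b := by
    rintro a rfl b rfl _; rfl
  have h0 := testSet_ideal hA hB (Set.empty_subset _)
  have h1 := testSet_ideal hA hB subset_rfl
  refine ⟨LinearMap.proj ⟨_, h1⟩ - LinearMap.proj ⟨_, h0⟩, fun r => ?_⟩
  simp only [LinearMap.sub_apply, LinearMap.proj_apply]
  rw [chiHat_test h1 h0 subset_rfl]
  simp

/-- mixed second difference functionals -/
theorem exists_mixed {t : ℕ} {α : ℕ → ℕ} (hF : IsFence t α) {k : ℕ} (h1k : 1 ≤ k)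
    (hkn : k + 2 ≤ nn t α)
    (hturn : (U t α k ∧ D t α (k + 1)) ∨ (D t α k ∧ U t α (k + 1))) :
    ∃ φ : (J t α → ℝ) →ₗ[ℝ] ℝ, (∀ r, φ (chiHat t α r) = 0) ∧ φ (fun _ => 1) = 0 ∧
      φ (Tg t α (xel t α (k + 1))) ≠ 0 ∧
      ∀ q, Elem t α q → (q : ℕ) ≠ k + 1 → φ (Tg t α q) = 0 := by
  have va := xel_val (t := t) (α := α) (j := k) (by omega)
  have vb := xel_val hkn
  set a := xel t α k with ha
  set b := xel t α (k + 2) with hb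
  have hab : a ≠ b := by intro h; have := congrArg Fin.val h; omega
  have nab : ¬ Le t α a b := fun h => by
    have h1 := (le_dir h k).1 (by omega) (by omega)
    have h2 := (le_dir h (k + 1)).1 (by omega) (by omega)
    rcases hturn with h3 | h3
    · exact not_UD h2 h3.2
    · exact not_UD h1 h3.1
  have nba : ¬ Le t α b a := fun h => by
    have h1 := (le_dir h k).2 (by omega) (by omega)
    have h2 := (le_dir h (k + 1)).2 (by omega) (by omega)
    rcases hturn with h3 | h3
    · exact not_UD h3.1 h1
    · exact not_UD h3.2 h2
  have hA : ∀ x ∈ ({a, b} : Set (V t α)), Elem t α x := by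
    rintro x (rfl | rfl) <;> simp only [Elem] <;> omega
  have hB : ∀ x ∈ ({a, b} : Set (V t α)), ∀ y ∈ ({a, b} : Set (V t α)), Le t α x y → x = y := by
    rintro x (rfl | rfl) y (rfl | rfl) h
    · rfl
    · exact (nab h).elim
    · exact (nba h).elim
    · rfl
  have sa : ({a} : Set (V t α)) ⊆ {a, b} := by simp
  have sb : ({b} : Set (V t α)) ⊆ {a, b} := by simp
  have h0 := testSet_ideal hA hB (Set.empty_subset _)
  have h1 := testSet_ideal hA hB sa
  have h2 := testSet_ideal hA hB sb
  have h3 := testSet_ideal hA hB subset_rfl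
  have c1 := chiHat_test h1 h0 sa
  have c2 := chiHat_test h2 h0 sb
  have c3 := chiHat_test h3 h0 subset_rfl
  -- values at a and b of the base ideal
  have e0a : chiHat t α a ⟨_, h0⟩ = 0 := by
    rw [chiHat, if_neg]
    rintro (h | h)
    · exact h.2 a (by simp) Relation.ReflTransGen.refl
    · exact h
  have e0b : chiHat t α b ⟨_, h0⟩ = 0 := by
    rw [chiHat, if_neg]
    rintro (h | h)
    · exact h.2 b (by simp) Relation.ReflTransGen.refl
    · exact h
  generalize hI0 : (⟨_, h0⟩ : J t α) = I0 at *
  generalize hI1 : (⟨_, h1⟩ : J t α) = I1 at *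
  generalize hI2 : (⟨_, h2⟩ : J t α) = I2 at *
  generalize hI3 : (⟨_, h3⟩ : J t α) = I3 at *
  have key : ∀ j, E t α j I1 = E t α j I0 + (if j = k then 1 else 0) ∧
      E t α j I2 = E t α j I0 + (if j = k + 2 then 1 else 0) ∧
      E t α j I3 = E t α j I0 + (if j = k then 1 else 0) + (if j = k + 2 then 1 else 0) := by
    intro j
    by_cases hj : 1 ≤ j ∧ j ≤ nn t α
    · have vj := xel_val hj.2
      have ea : xel t α j = a ↔ j = k := by rw [Fin.ext_iff, vj, va]
      have eb : xel t α j = b ↔ j = k + 2 := by rw [Fin.ext_iff, vj, vb]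
      simp only [E_mid _ hj.1 hj.2, c1, c2, c3, Set.mem_singleton_iff, Set.mem_insert_iff, ea, eb]
      refine ⟨trivial, trivial, ?_⟩
      by_cases x : j = k
      · simp [x]
      · simp [x]
    · have n1 : j ≠ k := by omega
      have n2 : j ≠ k + 2 := by omega
      simp only [n1, n2, if_false, add_zero]
      by_cases hj0 : j = 0
      · subst hj0; simp [E_zero]
      · have : nn t α < j := by omega
        simp only [E_big _ this, and_self]
  have e0k : E t α k I0 = 0 := by rw [E_mid _ h1k (by omega)]; exact e0a
  have e0k2 : E t α (k + 2) I0 = 0 := by rw [E_mid _ (by omega) hkn]; exact e0b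
  let pr : J t α → ((J t α → ℝ) →ₗ[ℝ] ℝ) := fun I => LinearMap.proj I
  have hpr : ∀ I f, pr I f = f I := fun I f => rfl
  refine ⟨pr I0 - pr I1 - pr I2 + pr I3,
    ?_, ?_, ?_, ?_⟩
  · intro r
    simp only [LinearMap.sub_apply, LinearMap.add_apply, hpr, c1, c2, c3,
      Set.mem_singleton_iff, Set.mem_insert_iff]
    by_cases x : r = a
    · simp [x, hab]; ring
    · simp [x]
  · simp [hpr]
  · simp only [LinearMap.sub_apply, LinearMap.add_apply, hpr]
    rcases hturn with ⟨u, d⟩ | ⟨d, u⟩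
    · simp only [Tg_peak hF _ (show k + 1 ≤ nn t α by omega) u d, key, e0k, e0k2]
      simp
    · simp only [Tg_valley hF _ (show k + 1 ≤ nn t α by omega) d u, key, e0k, e0k2]
      simp
  · intro q hq hqk
    obtain ⟨j, hj⟩ : ∃ j, (q : ℕ) = j + 1 := ⟨q - 1, by simp only [Elem] at hq; omega⟩
    have hjn : j + 1 ≤ nn t α := by have := q.2; omega
    rw [← xel_self q, hj]
    have hjk : j ≠ k := by omega
    simp only [LinearMap.sub_apply, LinearMap.add_apply, hpr]
    have hmt := nn_lt hF
    have prod : ∀ x y z w : ℝ, (if j = k + 2 then x else 0) * (if j + 2 = k then y else 0) = 0 := by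
      intro x y z w
      split_ifs <;> first | omega | simp
    rcases U_or_D (t := t) (α := α) (j := j) (by omega) with u | d <;>
    rcases U_or_D (t := t) (α := α) (j := j + 1) (by omega) with u' | d'
    · simp only [Tg_lin hF _ hjn (Or.inl ⟨u, u'⟩), key]; ring
    · simp only [Tg_peak hF _ hjn u d', key, hjk, if_false]
      have : ¬ (j + 2 = k + 2) := by omega
      simp only [this, if_false]
      linear_combination prod 1 1 0 0
    · simp only [Tg_valley hF _ hjn d u', key, hjk, if_false]
      have : ¬ (j + 2 = k + 2) := by omega
      simp only [this, if_false]
      linear_combination -prod 1 1 0 0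
    · simp only [Tg_lin hF _ hjn (Or.inr ⟨d, d'⟩), key]; ring

theorem convex_mem {M : Type*} [AddCommGroup M] [Module ℝ M] (W : Submodule ℝ M) (e : ℕ → M)
    (a : ℕ) (h : ∀ k, k + 2 ≤ a → e k - (2 : ℝ) • e (k + 1) + e (k + 2) ∈ W) (j : ℕ) (hj : j ≤ a) :
    (a : ℝ) • e j - ((a : ℝ) - j) • e 0 - (j : ℝ) • e a ∈ W := by
  have key : ∀ k, k + 1 ≤ a → e k - e 0 - (k : ℝ) • (e 1 - e 0) ∈ W ∧
      e (k + 1) - e 0 - ((k + 1 : ℕ) : ℝ) • (e 1 - e 0) ∈ W := by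
    intro k
    induction k with
    | zero => intro _; simp
    | succ k ih =>
      intro hk
      obtain ⟨h1, h2⟩ := ih (by omega)
      refine ⟨h2, ?_⟩
      have h3 := h k (by omega)
      have := W.add_mem (W.sub_mem h3 h1) (W.smul_mem 2 h2)
      convert this using 1
      push_cast
      module
  rcases Nat.eq_zero_or_pos a with h0 | h0
  · subst h0
    have : j = 0 := by omega
    subst this; simp
  have ha := (key (a - 1) (by omega)).2
  rw [show a - 1 + 1 = a by omega] at ha
  have hj' : e j - e 0 - (j : ℝ) • (e 1 - e 0) ∈ W := by
    rcases Nat.eq_zero_or_pos j with h1 | h1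
    · subst h1; simp
    · have := (key (j - 1) (by omega)).2
      rwa [show j - 1 + 1 = j by omega] at this
  have := W.sub_mem (W.smul_mem (a : ℝ) hj') (W.smul_mem (j : ℝ) ha)
  convert this using 1
  module

/-- the elements of `B_I(F)`, indexed by position -/
noncomputable def Bq (t : ℕ) (α : ℕ → ℕ) (i j : ℕ) : J t α → ℝ :=
  (α i : ℝ) • chiHat t α (xel t α (m α i + j)) - ((α i : ℝ) - j) • chiHat t α (xel t α (m α i))
    - (j : ℝ) • chiHat t α (xel t α (m α (i + 1)))

theorem seg_U_or_D {t : ℕ} {α : ℕ → ℕ} {i : ℕ} (hi : i < t) :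
    (∀ j, m α i ≤ j → j < m α (i + 1) → U t α j) ∨ (∀ j, m α i ≤ j → j < m α (i + 1) → D t α j) := by
  rcases Nat.mod_two_eq_zero_or_one i with h3 | h3
  · exact Or.inl fun j h1 h2 => ⟨i, hi, h3, h1, h2⟩
  · exact Or.inr fun j h1 h2 => ⟨i, hi, h3, h1, h2⟩

theorem m_le_t {t : ℕ} {α : ℕ → ℕ} (hF : IsFence t α) {i : ℕ} (hi : i < t) :
    m α (i + 1) ≤ nn t α + 1 := by
  rw [nn_lt hF]; exact m_mono α hi

theorem chiHat_mem {t : ℕ} {α : ℕ → ℕ} (p : V t α) : chiHat t α p ∈ chiHatSpan t α := by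
  by_cases h : (p : ℕ) = 0
  · have : chiHat t α p = 0 := funext fun I => chiHat_dummy h I
    rw [this]; exact Submodule.zero_mem _
  · exact Submodule.subset_span ⟨p, by simp only [Elem]; omega, rfl⟩

theorem const_mem {t : ℕ} {α : ℕ → ℕ} (c : ℝ) : (fun _ => c) ∈ ConstPlusTogg t α := by
  refine Submodule.mem_sup_right ?_
  rw [Submodule.mem_span_singleton]
  exact ⟨c, by ext; simp⟩

theorem Tg_mem {t : ℕ} {α : ℕ → ℕ} {p : V t α} (h : Elem t α p) :
    Tg t α p ∈ ConstPlusTogg t α :=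
  Submodule.mem_sup_left (Submodule.subset_span ⟨p, h, rfl⟩)

theorem chiHat_sub_E {t : ℕ} {α : ℕ → ℕ} {j : ℕ} (hj : j ≤ nn t α + 1) :
    chiHat t α (xel t α j) - E t α j ∈ ConstPlusTogg t α := by
  by_cases h0 : j = 0
  · have : chiHat t α (xel t α j) - E t α j = fun _ => -1 := by
      subst h0
      ext I
      simp [E_zero, chiHat_dummy (p := xel t α 0) (by simp [xel]) I]
    rw [this]; exact const_mem _
  by_cases h1 : j = nn t α + 1
  · have : chiHat t α (xel t α j) - E t α j = fun _ => -(if D t α (nn t α) then 1 else 0) := by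
      ext I
      rw [Pi.sub_apply, E_big I (by omega), chiHat_dummy (by simp [xel, h1]) I, zero_sub]
    rw [this]; exact const_mem _
  · have : chiHat t α (xel t α j) - E t α j = 0 := by
      ext I
      rw [Pi.sub_apply, E_mid I (by omega) (by omega)]; simp
    rw [this]; exact Submodule.zero_mem _

theorem Bq_mem {t : ℕ} {α : ℕ → ℕ} (hF : IsFence t α) {i j : ℕ} (hi : i < t) (hj : j ≤ α i) :
    Bq t α i j ∈ IT t α := by
  have hm := m_le_t hF hi
  have hs := m_succ α i
  refine ⟨?_, ?_⟩
  · exact Submodule.sub_mem _ (Submodule.sub_mem _ (Submodule.smul_mem _ _ (chiHat_mem _))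
      (Submodule.smul_mem _ _ (chiHat_mem _))) (Submodule.smul_mem _ _ (chiHat_mem _))
  · have h1 := convex_mem (ConstPlusTogg t α) (fun k => E t α (m α i + k)) (α i) (by
      intro k hk
      have hT : Elem t α (xel t α (m α i + k + 1)) := by
        simp only [Elem]; rw [xel_val (by omega)]; omega
      have := Tg_mem hT
      convert this using 1
      ext I
      rw [Tg_lin hF I (by omega)]
      · simp [add_assoc]
      · rcases seg_U_or_D (α := α) hi with h | h
        · exact Or.inl ⟨h _ (by omega) (by omega), h _ (by omega) (by omega)⟩
        · exact Or.inr ⟨h _ (by omega) (by omega), h _ (by omega) (by omega)⟩) j hj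
    have h2 := chiHat_sub_E (t := t) (α := α) (j := m α i + j) (by omega)
    have h3 := chiHat_sub_E (t := t) (α := α) (j := m α i) (by omega)
    have h4 := chiHat_sub_E (t := t) (α := α) (j := m α i + α i) (by omega)
    have := Submodule.add_mem _ h1 (Submodule.sub_mem _ (Submodule.sub_mem _
      (Submodule.smul_mem _ (α i : ℝ) h2) (Submodule.smul_mem _ ((α i : ℝ) - j) h3))
      (Submodule.smul_mem _ (j : ℝ) h4))
    change Bq t α i j ∈ ConstPlusTogg t α
    convert this using 1
    simp only [Bq, hs, add_zero]
    module

abbrev Idx (t : ℕ) (α : ℕ → ℕ) := Σ i : Fin t, Fin (α i - 1)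

noncomputable def BF (t : ℕ) (α : ℕ → ℕ) (x : Idx t α) : J t α → ℝ := Bq t α x.1 (x.2 + 1)

theorem BI_eq {t : ℕ} {α : ℕ → ℕ} (hF : IsFence t α) : BI t α = Set.range (BF t α) := by
  have hz : xel t α (m α t) = xel t α 0 := by
    simp [xel, ← nn_lt hF]
  have main : ∀ i j, i < t → 1 ≤ j → j ≤ α i - 1 →
      (fun I => (α i : ℝ) * chiHat t α (uElx t α (i + 1) j) I
          - (j : ℝ) * chiHat t α (peakx t α (i + 1)) I
          - ((α i : ℝ) - (j : ℝ)) * chiHat t α (valleyx t α (i + 1)) I)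
       = if i % 2 = 0 then Bq t α i j else Bq t α i (α i - j) := by
    intro i j hi h1 h2
    have hs := m_succ α i
    have hp : ∀ k, (if k + 1 ≤ t then m α k else 0) = m α k ∨ t ≤ k := by
      intro k; by_cases h : k + 1 ≤ t
      · left; simp [h]
      · right; omega
    have hx : xel t α (if i + 1 + 1 ≤ t then m α (i + 1) else 0) = xel t α (m α (i + 1)) := by
      by_cases h : i + 1 + 1 ≤ t
      · simp [h]
      · rw [if_neg h, show i + 1 = t by omega, hz]
    have hy : (if 2 ≤ i + 1 then m α i else 0) = m α i := by
      by_cases h : 2 ≤ i + 1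
      · simp [h]
      · rw [if_neg h, show i = 0 by omega, m_zero]
    ext I
    by_cases h : i % 2 = 0
    · have h' : (i + 1) % 2 = 1 := by omega
      simp only [h, h', uElx, uEl, peakx, peakN, valleyx, valleyN, Nat.add_sub_cancel, if_true, hx,
        hy, Bq, Pi.sub_apply, Pi.smul_apply, smul_eq_mul]
      ring
    · have h' : ¬ (i + 1) % 2 = 1 := by omega
      simp only [h, h', uElx, uEl, peakx, peakN, valleyx, valleyN, Nat.add_sub_cancel, if_false, hx,
        Bq, Pi.sub_apply, Pi.smul_apply, smul_eq_mul]
      rw [show m α i + (α i - j) = m α (i + 1) - j by omega, Nat.cast_sub (by omega)]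
      ring
  ext f
  constructor
  · rintro ⟨i, j, h1, h2, h3, h4, rfl⟩
    obtain ⟨i, rfl⟩ : ∃ i', i = i' + 1 := ⟨i - 1, by omega⟩
    simp only [Nat.add_sub_cancel] at h4 ⊢
    rw [main i j (by omega) h3 h4]
    by_cases h : i % 2 = 0
    · refine ⟨⟨⟨i, by omega⟩, ⟨j - 1, by simp only; omega⟩⟩, ?_⟩
      simp only [BF, h, if_true]
      rw [show j - 1 + 1 = j by omega]
    · refine ⟨⟨⟨i, by omega⟩, ⟨α i - j - 1, by simp only; omega⟩⟩, ?_⟩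
      simp only [BF, h, if_false]
      rw [show α i - j - 1 + 1 = α i - j by omega]
  · rintro ⟨⟨⟨i, hi⟩, ⟨j, hj⟩⟩, rfl⟩
    simp only at hj
    by_cases h : i % 2 = 0
    · refine ⟨i + 1, j + 1, by omega, by omega, by omega, by simp only [Nat.add_sub_cancel]; omega, ?_⟩
      simp only [Nat.add_sub_cancel]
      rw [main i (j + 1) hi (by omega) (by omega)]
      simp [h, BF]
    · refine ⟨i + 1, α i - (j + 1), by omega, by omega, by omega,
        by simp only [Nat.add_sub_cancel]; omega, ?_⟩
      simp only [Nat.add_sub_cancel]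
      rw [main i (α i - (j + 1)) hi (by omega) (by omega)]
      simp only [h, BF, if_false]
      rw [show α i - (α i - (j + 1)) = j + 1 by omega]

theorem BF_indep {t : ℕ} {α : ℕ → ℕ} (hF : IsFence t α) : LinearIndependent ℝ (BF t α) := by
  have hdual : ∀ x : Idx t α, ∃ φ : (J t α → ℝ) →ₗ[ℝ] ℝ, φ (BF t α x) ≠ 0 ∧
      ∀ y, y ≠ x → φ (BF t α y) = 0 := by
    rintro ⟨⟨i, hi⟩, ⟨j, hj⟩⟩
    simp only at hj
    have hm := m_le_t hF hi
    have hs := m_succ α i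
    have hv : (xel t α (m α i + (j + 1)) : ℕ) = m α i + (j + 1) := xel_val (by omega)
    obtain ⟨φ, hφ⟩ := exists_dual (xel t α (m α i + (j + 1))) (by simp only [Elem]; omega)
    have hsh : ∀ i' < t + 1, φ (chiHat t α (xel t α (m α i'))) = 0 := by
      intro i' hi'
      rw [hφ, if_neg]
      intro hc
      have hc := congrArg Fin.val hc
      rw [hv] at hc
      by_cases h : i' = t
      · rw [h, ← nn_lt hF] at hc
        simp [xel] at hc
      · have h1 := m_le_t hF (show i' < t by omega)
        have h2 := m_succ α i'
        have h3 := hF.2.1 i' (by omega)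
        rw [xel_val (by omega)] at hc
        have := seg_unique α (j := m α i') le_rfl (by omega) (i' := i) (by omega) (by omega)
        subst this
        omega
    refine ⟨φ, ?_, ?_⟩
    · simp only [BF, Bq, map_sub, map_smul]
      rw [hsh i (by omega), hsh (i + 1) (by omega), hφ]
      simp
      omega
    · rintro ⟨⟨i', hi'⟩, ⟨j', hj'⟩⟩ hne
      simp only at hj'
      have hm' := m_le_t hF hi'
      have hs' := m_succ α i'
      simp only [BF, Bq, map_sub, map_smul]
      rw [hsh i' (by omega), hsh (i' + 1) (by omega), hφ, if_neg]
      · simp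
      · intro hc
        have hc := congrArg Fin.val hc
        rw [hv, xel_val (by omega)] at hc
        have := seg_unique α (j := m α i' + (j' + 1)) (i := i') (by omega) (by omega) (i' := i) (by omega) (by omega)
        subst this
        apply hne
        have : j' = j := by omega
        subst this
        rfl
  rw [Fintype.linearIndependent_iff]
  intro g hg x
  obtain ⟨φ, h1, h2⟩ := hdual x
  have := congrArg φ hg
  rw [map_sum, Finset.sum_eq_single x] at this
  · simpa [h1] using this
  · intro y _ hy; simp [h2 y hy]
  · simp

/-- the empty ideal -/
def emptyJ (t : ℕ) (α : ℕ → ℕ) : J t α := ⟨∅, by simp, by simp⟩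

/-- normalized toggleability statistics of unshared elements. -/
noncomputable def TF (t : ℕ) (α : ℕ → ℕ) (x : Idx t α) : J t α → ℝ :=
  Tg t α (xel t α (m α x.1 + (x.2 + 1))) - fun _ => Tg t α (xel t α (m α x.1 + (x.2 + 1))) (emptyJ t α)

theorem elem_cases {t : ℕ} {α : ℕ → ℕ} (hF : IsFence t α) (q : ℕ) (h1 : 1 ≤ q) (h2 : q ≤ nn t α) :
    (∃ x : Idx t α, q = m α x.1 + (x.2 + 1)) ∨
    (∃ k, q = k + 1 ∧ 1 ≤ k ∧ k + 2 ≤ nn t α ∧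
      ((U t α k ∧ D t α (k + 1)) ∨ (D t α k ∧ U t α (k + 1)))) := by
  have hn := nn_lt hF
  obtain ⟨i, hi, h3, h4⟩ := exists_seg t α q (by omega)
  have hs := m_succ α i
  by_cases h : q = m α i
  · right
    have hi0 : i ≠ 0 := by rintro rfl; rw [m_zero] at h; omega
    obtain ⟨i, rfl⟩ : ∃ i', i = i' + 1 := ⟨i - 1, by omega⟩
    have hs' := m_succ α i
    have h5 := hF.2.1 i (by omega)
    have h6 := hF.2.2.1
    have h7 := m_mono α (show 1 ≤ i + 1 by omega)
    have h8 := m_succ α 0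
    have h9 := m_mono α (show i + 1 ≤ t - 1 by omega)
    have h10 := m_succ α (t - 1)
    have h11 := hF.2.2.2
    rw [show t - 1 + 1 = t by omega] at h10
    simp only [zero_add, m_zero] at h8
    refine ⟨q - 1, by omega, by omega, by omega, ?_⟩
    rcases Nat.mod_two_eq_zero_or_one i with e | e
    · exact Or.inl ⟨⟨i, by omega, e, by omega, by omega⟩, ⟨i + 1, by omega, by omega, by omega, by omega⟩⟩
    · exact Or.inr ⟨⟨i, by omega, e, by omega, by omega⟩, ⟨i + 1, by omega, by omega, by omega, by omega⟩⟩
  · left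
    refine ⟨⟨⟨i, hi⟩, ⟨q - m α i - 1, by simp only; omega⟩⟩, ?_⟩
    simp only
    omega

theorem IT_le {t : ℕ} {α : ℕ → ℕ} (hF : IsFence t α) :
    IT t α ≤ Submodule.span ℝ (Set.range (TF t α)) := by
  rintro f ⟨hf1, hf2⟩
  obtain ⟨g, hg, c, hc, hgc⟩ := Submodule.mem_sup.1 hf2
  obtain ⟨c, rfl⟩ := Submodule.mem_span_singleton.1 hc
  have hset : {f | ∃ p : V t α, Elem t α p ∧ f = Tg t α p} =
      Tg t α '' (↑(Finset.univ.filter (Elem t α)) : Set (V t α)) := by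
    ext f; simp [eq_comm]
  rw [ToggSpan, hset, Submodule.mem_span_image_finset_iff_exists_fun'] at hg
  obtain ⟨d, rfl⟩ := hg
  have hzero : ∀ k, 1 ≤ k → k + 2 ≤ nn t α →
      ((U t α k ∧ D t α (k + 1)) ∨ (D t α k ∧ U t α (k + 1))) → d (xel t α (k + 1)) = 0 := by
    intro k hk1 hk2 hturn
    obtain ⟨φ, hφ1, hφ2, hφ3, hφ4⟩ := exists_mixed hF hk1 hk2 hturn
    have h0 : φ f = 0 := by
      have : chiHatSpan t α ≤ LinearMap.ker φ := by
        rw [chiHatSpan, Submodule.span_le]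
        rintro _ ⟨p, _, rfl⟩
        exact hφ1 p
      exact this hf1
    have hv : (xel t α (k + 1) : ℕ) = k + 1 := xel_val (by omega)
    rw [← hgc, map_add, map_smul, hφ2, map_sum, Finset.sum_eq_single (xel t α (k + 1))] at h0
    · simpa [hφ3] using h0
    · intro q hq hne
      rw [map_smul, hφ4 q (by simpa using hq), smul_zero]
      intro h; exact hne (Fin.ext (by rw [hv, h]))
    · intro h
      exfalso; apply h; simp only [Finset.mem_filter, Finset.mem_univ, true_and, Elem]; omega
  have hfe : f (emptyJ t α) = 0 := by
    have : chiHatSpan t α ≤ LinearMap.ker (LinearMap.proj (emptyJ t α) : (J t α → ℝ) →ₗ[ℝ] ℝ) := by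
      rw [chiHatSpan, Submodule.span_le]
      rintro _ ⟨p, _, rfl⟩
      simp [chiHat, emptyJ]
    exact this hf1
  have : f = ∑ q ∈ Finset.univ.filter (Elem t α),
      d q • (Tg t α q - fun _ => Tg t α q (emptyJ t α)) := by
    ext I
    have h1 := congrFun hgc I
    have h2 := congrFun hgc (emptyJ t α)
    rw [hfe] at h2
    simp only [Pi.add_apply, Finset.sum_apply, Pi.smul_apply, Pi.sub_apply, smul_eq_mul, mul_sub,
      Finset.sum_sub_distrib] at h1 h2 ⊢
    linarith
  rw [this]
  refine Submodule.sum_mem _ fun q hq => ?_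
  have hq : 1 ≤ (q : ℕ) := by simpa [Elem] using hq
  rcases elem_cases hF q hq (by have := q.2; omega) with ⟨x, hx⟩ | ⟨k, hk, h1, h2, h3⟩
  · refine Submodule.smul_mem _ _ (Submodule.subset_span ⟨x, ?_⟩)
    rw [TF, ← hx, xel_self]
  · have := hzero k h1 h2 h3
    rw [← hk, xel_self] at this
    rw [this, zero_smul]
    exact Submodule.zero_mem _

theorem card_Idx (t : ℕ) (α : ℕ → ℕ) : Fintype.card (Idx t α) = ∑ i ∈ Finset.range t, (α i - 1) := by
  simp [Finset.sum_range]

/-- Theorem `oic togg dim`.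
`B_I(F)` is a basis of the order ideal toggleability space `I_T(F)`; in particular
`dim I_T(F) = Σ_{i=1}^t (α_i − 1)`. -/
theorem statement8 (t : ℕ) (α : ℕ → ℕ) (hF : IsFence t α) :
    BI t α ⊆ (IT t α : Set (J t α → ℝ))
    ∧ LinearIndependent ℝ (fun f : BI t α => (f : J t α → ℝ))
    ∧ Submodule.span ℝ (BI t α) = IT t α
    ∧ Module.finrank ℝ (IT t α) = ∑ i ∈ Finset.range t, (α i - 1) := by
  have hsub : BI t α ⊆ (IT t α : Set (J t α → ℝ)) := by
    rw [BI_eq hF]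
    rintro _ ⟨⟨i, j⟩, rfl⟩
    exact Bq_mem hF i.2 (by have := j.2; omega)
  have hind := BF_indep hF
  have hle := IT_le hF
  have hfin : FiniteDimensional ℝ (Submodule.span ℝ (Set.range (TF t α))) :=
    FiniteDimensional.span_of_finite ℝ (Set.finite_range _)
  have hfinIT : FiniteDimensional ℝ (IT t α) := Submodule.finiteDimensional_of_le hle
  have h1 : Module.finrank ℝ (IT t α) ≤ Fintype.card (Idx t α) :=
    (Submodule.finrank_mono hle).trans (finrank_range_le_card _)
  have h2 : Module.finrank ℝ (Submodule.span ℝ (BI t α)) = Fintype.card (Idx t α) := by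
    rw [BI_eq hF]; exact finrank_span_eq_card hind
  have h3 : Submodule.span ℝ (BI t α) ≤ IT t α := Submodule.span_le.2 hsub
  have h4 : Submodule.span ℝ (BI t α) = IT t α :=
    Submodule.eq_of_le_of_finrank_le h3 (by rw [h2]; exact h1)
  refine ⟨hsub, ?_, h4, ?_⟩
  · rw [BI_eq hF]
    exact hind.linearIndepOn_id
  · rw [← h4, h2, card_Idx]

end Fence
end

section
/- Let a ≥ 2 and let F = F̆(a,a,a), with elements x_1,…,x_{3a−1}, peak x_a and valley x_{2a}. Then, as functions on J(F): χ_{x_a} − χ_{x_{2a}} = Σ_{i=1}^{a} (−i·T_{x_i}) − (a−1)·T_{x_{2a}} + Σ_{i=1}^{a−1} (−i·T_{x_{3a−i}}) + Σ_{i=1}^{a−1} Σ_{j=0}^{i} a·T_{{x_i, x_{2a+j}}} + Σ_{j=1}^{a−1} a·T_{{x_a, x_{2a+j}}} + Σ_{i=1}^{a−1} (−a·T_{{x_i, x_{2a−i}, x_{2a+i}}}), where each subscripted set is an antichain of F and T_A denotes the antichain toggleability statistic. -/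
open scoped Classical

namespace Fence

theorem chain_cut (f : ℕ → Prop) (n : ℕ) (h : ∀ i, i + 1 < n → f (i + 1) → f i) :
    ∃ P ≤ n, ∀ i < n, (f i ↔ i < P) := by
  induction n with
  | zero => exact ⟨0, le_refl _, fun i hi => by omega⟩
  | succ n ih =>
    obtain ⟨P, hP, hf⟩ := ih (fun i hi => h i (by omega))
    by_cases hn : f n
    · refine ⟨n + 1, le_refl _, fun i hi => ?_⟩
      have hall : ∀ d, ∀ i, i + d = n → f i := by
        intro d
        induction d with
        | zero => intro i hi; simpa [← hi] using hn
        | succ d ihd => intro i hi; exact h i (by omega) (ihd (i + 1) (by omega))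
      exact ⟨fun _ => hi, fun _ => hall (n - i) i (by omega)⟩
    · refine ⟨P, by omega, fun i hi => ?_⟩
      by_cases hin : i = n
      · subst hin
        exact ⟨fun h' => absurd h' hn, fun h' => by omega⟩
      · exact hf i (by omega)

theorem nn3 (a : ℕ) : nn 3 (fun _ => a) = 3 * a - 1 := by
  simp [nn, m]

theorem cov3 (a : ℕ) (p q : V 3 (fun _ => a)) :
    Cov 3 (fun _ => a) p q ↔
      ((q : ℕ) = p + 1 ∧ 1 ≤ (p : ℕ) ∧ (p : ℕ) < a) ∨
      ((q : ℕ) = p + 1 ∧ 1 ≤ (p : ℕ) ∧ 2 * a ≤ (p : ℕ) ∧ (q : ℕ) ≤ 3 * a - 1) ∨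
      ((p : ℕ) = q + 1 ∧ 1 ≤ (q : ℕ) ∧ a ≤ (q : ℕ) ∧ (q : ℕ) < 2 * a) := by
  have hm : ∀ i, m (fun _ => a) i = i * a := by intro i; simp [m]
  have hn := nn3 a
  have hp := p.2
  have hq := q.2
  unfold Cov
  simp only [hm]
  constructor
  · rintro ⟨i, hi, h⟩
    interval_cases i <;> omega
  · rintro (h | h | h)
    · exact ⟨0, by omega, by omega⟩
    · exact ⟨2, by omega, by omega⟩
    · exact ⟨1, by omega, by omega⟩

theorem maxIn_iff_s10 {a : ℕ} (I : J 3 (fun _ => a)) (p : V 3 (fun _ => a)) :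
    MaxIn 3 (fun _ => a) I.1 p ↔ p ∈ I.1 ∧ ∀ q, Cov 3 (fun _ => a) p q → q ∉ I.1 := by
  constructor
  · rintro ⟨h1, h2⟩
    refine ⟨h1, fun q hq hqI => ?_⟩
    have := h2 q hqI (Relation.ReflTransGen.single hq)
    subst this
    rw [cov3] at hq
    omega
  · rintro ⟨h1, h2⟩
    refine ⟨h1, fun q hqI hle => ?_⟩
    rcases Relation.ReflTransGen.cases_head hle with h | ⟨c, hc, hcq⟩
    · exact h.symm
    · exact absurd (I.2.2 c q hcq hqI) (h2 c hc)

theorem minOut_iff_s10 {a : ℕ} (I : J 3 (fun _ => a)) (p : V 3 (fun _ => a)) :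
    MinOut 3 (fun _ => a) I.1 p ↔
      1 ≤ (p : ℕ) ∧ p ∉ I.1 ∧ ∀ q, Cov 3 (fun _ => a) q p → q ∈ I.1 := by
  constructor
  · rintro ⟨h0, h1, h2⟩
    refine ⟨h0, h1, fun q hq => ?_⟩
    by_contra hqI
    have := h2 q (cov_elem hq).1 hqI (Relation.ReflTransGen.single hq)
    subst this
    rw [cov3] at hq
    omega
  · rintro ⟨h0, h1, h2⟩
    refine ⟨h0, h1, fun q _ hqI hle => ?_⟩
    rcases Relation.ReflTransGen.cases_tail hle with h | ⟨c, hqc, hc⟩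
    · exact h.symm
    · exact absurd (I.2.2 q c hqc (h2 c hc)) hqI

theorem xel_val_s10 {a k : ℕ} (hk : k < 3 * a) : ((xel 3 (fun _ => a) k : V 3 (fun _ => a)) : ℕ) = k := by
  simp only [xel, nn3]
  exact Nat.mod_eq_of_lt (by omega)

theorem xel_of_val {a k : ℕ} (q : V 3 (fun _ => a)) (h : (q : ℕ) = k) :
    q = xel 3 (fun _ => a) k := by
  have := q.2
  have hn := nn3 a
  apply Fin.ext
  by_cases ha : a = 0
  · subst ha
    have h2 := (xel 3 (fun _ => 0) k).2
    omega
  · rw [xel_val_s10 (by omega)]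
    exact h

theorem maxIn_xel {a k : ℕ} (I : J 3 (fun _ => a)) (h1 : 1 ≤ k) (h2 : k < 3 * a) :
    MaxIn 3 (fun _ => a) I.1 (xel 3 (fun _ => a) k) ↔
      xel 3 (fun _ => a) k ∈ I.1 ∧ (k < a → xel 3 (fun _ => a) (k + 1) ∉ I.1) ∧
      (2 * a ≤ k → k + 1 < 3 * a → xel 3 (fun _ => a) (k + 1) ∉ I.1) ∧
      (a < k → k ≤ 2 * a → xel 3 (fun _ => a) (k - 1) ∉ I.1) := by
  rw [maxIn_iff_s10]
  refine and_congr_right fun _ => ?_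
  simp only [cov3, xel_val_s10 h2]
  constructor
  · intro h
    refine ⟨fun _ => h _ ?_, fun _ _ => h _ ?_, fun _ _ => h _ ?_⟩ <;>
      rw [xel_val_s10 (by omega)] <;> omega
  · rintro ⟨ha, hb, hc⟩ q hq
    rcases hq with hq | hq | hq
    · rw [xel_of_val q hq.1]; exact ha hq.2.2
    · rw [xel_of_val q hq.1]; exact hb hq.2.2.1 (by omega)
    · rw [xel_of_val q (k := k - 1) (by omega)]; exact hc (by omega) (by omega)

theorem minOut_xel {a k : ℕ} (I : J 3 (fun _ => a)) (h1 : 1 ≤ k) (h2 : k < 3 * a) :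
    MinOut 3 (fun _ => a) I.1 (xel 3 (fun _ => a) k) ↔
      xel 3 (fun _ => a) k ∉ I.1 ∧ (1 < k → k ≤ a → xel 3 (fun _ => a) (k - 1) ∈ I.1) ∧
      (2 * a < k → xel 3 (fun _ => a) (k - 1) ∈ I.1) ∧
      (a ≤ k → k < 2 * a → xel 3 (fun _ => a) (k + 1) ∈ I.1) := by
  rw [minOut_iff_s10, xel_val_s10 h2]
  simp only [h1, true_and]
  refine and_congr_right fun _ => ?_
  simp only [cov3, xel_val_s10 h2]
  constructor
  · intro h
    refine ⟨fun _ _ => h _ ?_, fun _ => h _ ?_, fun _ _ => h _ ?_⟩ <;>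
      rw [xel_val_s10 (by omega)] <;> omega
  · rintro ⟨ha, hb, hc⟩ q hq
    rcases hq with hq | hq | hq
    · rw [xel_of_val q (k := k - 1) (by omega)]; exact ha (by omega) (by omega)
    · rw [xel_of_val q (k := k - 1) (by omega)]; exact hb (by omega)
    · rw [xel_of_val q (k := k + 1) (by omega)]; exact hc (by omega) (by omega)

/-- Parametrisation of the ideals by three cut positions. -/
theorem params {a : ℕ} (ha : 2 ≤ a) (I : J 3 (fun _ => a)) :
    ∃ P Q R : ℕ, P ≤ a ∧ Q ≤ a ∧ R ≤ a ∧ (P = a → Q = a) ∧ (Q = 0 ↔ R = 0) ∧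
      (∀ k, 1 ≤ k → k ≤ a → (xel 3 (fun _ => a) k ∈ I.1 ↔ k ≤ P)) ∧
      (∀ k, a < k → k ≤ 2 * a → (xel 3 (fun _ => a) k ∈ I.1 ↔ 2 * a < k + Q)) ∧
      (∀ k, 2 * a ≤ k → k < 3 * a → (xel 3 (fun _ => a) k ∈ I.1 ↔ k < 2 * a + R)) := by
  have cl : ∀ k l, k < 3 * a → l < 3 * a → Cov 3 (fun _ => a) (xel 3 (fun _ => a) k)
      (xel 3 (fun _ => a) l) → xel 3 (fun _ => a) l ∈ I.1 → xel 3 (fun _ => a) k ∈ I.1 :=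
    fun k l _ _ h => I.2.2 _ _ (Relation.ReflTransGen.single h)
  have cl' : ∀ k l, k < 3 * a → l < 3 * a →
      ((l = k + 1 ∧ 1 ≤ k ∧ k < a) ∨ (l = k + 1 ∧ 1 ≤ k ∧ 2 * a ≤ k ∧ l ≤ 3 * a - 1) ∨
      (k = l + 1 ∧ 1 ≤ l ∧ a ≤ l ∧ l < 2 * a)) →
      xel 3 (fun _ => a) l ∈ I.1 → xel 3 (fun _ => a) k ∈ I.1 := by
    intro k l hk hl h
    apply cl k l hk hl
    rw [cov3, xel_val_s10 hk, xel_val_s10 hl]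
    exact h
  obtain ⟨P, hP, hPf⟩ := chain_cut (fun i => xel 3 (fun _ => a) (i + 1) ∈ I.1) a
    (fun i hi => cl' _ _ (by omega) (by omega) (by omega))
  obtain ⟨Q, hQ, hQf⟩ := chain_cut (fun i => xel 3 (fun _ => a) (2 * a - i) ∈ I.1) a
    (fun i hi => cl' _ _ (by omega) (by omega) (by omega))
  obtain ⟨R, hR, hRf⟩ := chain_cut (fun i => xel 3 (fun _ => a) (2 * a + i) ∈ I.1) a
    (fun i hi => cl' _ _ (by omega) (by omega) (by omega))
  have e1 : ∀ k, 1 ≤ k → k ≤ a → (xel 3 (fun _ => a) k ∈ I.1 ↔ k ≤ P) := by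
    intro k h1 h2
    have := hPf (k - 1) (by omega)
    simp only [Nat.sub_add_cancel h1] at this
    rw [this]; omega
  have e2 : ∀ k, a < k → k ≤ 2 * a → (xel 3 (fun _ => a) k ∈ I.1 ↔ 2 * a < k + Q) := by
    intro k h1 h2
    have := hQf (2 * a - k) (by omega)
    simp only [Nat.sub_sub_self h2] at this
    rw [this]; omega
  have e3 : ∀ k, 2 * a ≤ k → k < 3 * a → (xel 3 (fun _ => a) k ∈ I.1 ↔ k < 2 * a + R) := by
    intro k h1 h2
    have := hRf (k - 2 * a) (by omega)
    simp only [Nat.add_sub_cancel' h1] at this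
    rw [this]; omega
  refine ⟨P, Q, R, hP, hQ, hR, ?_, ?_, e1, e2, e3⟩
  · intro h
    have h1 := (e1 a (by omega) (by omega)).2 (by omega)
    have h2 := cl' (a + 1) a (by omega) (by omega) (by omega) h1
    rw [e2 _ (by omega) (by omega)] at h2
    omega
  · have h1 := e2 (2 * a) (by omega) (by omega)
    have h2 := e3 (2 * a) (by omega) (by omega)
    rw [h1] at h2
    omega

theorem TA_eq {a : ℕ} (A : Set (V 3 (fun _ => a))) (hA : A.Nonempty) (I : J 3 (fun _ => a)) :
    TA 3 (fun _ => a) A I = (if ∀ p ∈ A, MinOut 3 (fun _ => a) I.1 p then (1 : ℝ) else 0)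
      - (if ∀ p ∈ A, MaxIn 3 (fun _ => a) I.1 p then (1 : ℝ) else 0) := by
  unfold TA
  obtain ⟨p, hp⟩ := hA
  by_cases h1 : ∀ p ∈ A, MinOut 3 (fun _ => a) I.1 p
  · have h2 : ¬ ∀ p ∈ A, MaxIn 3 (fun _ => a) I.1 p := fun h => (h1 p hp).2.1 (h p hp).1
    simp [h1, h2]
  · by_cases h2 : ∀ p ∈ A, MaxIn 3 (fun _ => a) I.1 p
    · rw [if_neg h1, if_pos h2, if_neg h1, if_pos h2]; norm_num
    · rw [if_neg h1, if_neg h2, if_neg h1, if_neg h2]; norm_num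

theorem sum_pick (s : Finset ℕ) (f : ℕ → ℝ) (p : ℕ → Prop) [DecidablePred p] (k : ℕ)
    (C : Prop) [Decidable C] (h : ∀ i ∈ s, (p i ↔ i = k ∧ C)) :
    ∑ i ∈ s, f i * (if p i then (1 : ℝ) else 0) = if k ∈ s ∧ C then f k else 0 := by
  have : ∀ i ∈ s, f i * (if p i then (1 : ℝ) else 0) = if i = k then (if C then f k else 0) else 0 := by
    intro i hi
    by_cases hk : i = k
    · subst hk
      simp [h i hi]
    · simp [h i hi, hk]
  rw [Finset.sum_congr rfl this, Finset.sum_ite_eq']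
  by_cases hk : k ∈ s <;> simp [hk]

theorem sum_TA {a : ℕ} (I : J 3 (fun _ => a)) (s : Finset ℕ) (f : ℕ → ℝ)
    (A : ℕ → Set (V 3 (fun _ => a))) (hA : ∀ i, (A i).Nonempty) (k l : ℕ) (C D : Prop)
    [Decidable C] [Decidable D]
    (h1 : ∀ i ∈ s, ((∀ p ∈ A i, MinOut 3 (fun _ => a) I.1 p) ↔ i = k ∧ C))
    (h2 : ∀ i ∈ s, ((∀ p ∈ A i, MaxIn 3 (fun _ => a) I.1 p) ↔ i = l ∧ D)) :
    ∑ i ∈ s, f i * TA 3 (fun _ => a) (A i) I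
      = (if k ∈ s ∧ C then f k else 0) - (if l ∈ s ∧ D then f l else 0) := by
  rw [← sum_pick s f _ k C h1, ← sum_pick s f _ l D h2, ← Finset.sum_sub_distrib]
  refine Finset.sum_congr rfl fun i _ => ?_
  rw [TA_eq _ (hA i), mul_sub]

set_option maxHeartbeats 4000000 in
theorem arith_id (a P Q R : ℕ) (ha : 2 ≤ a) (hP : P ≤ a) (hQ : Q ≤ a) (hR : R ≤ a)
    (hPQ : P = a → Q = a) (hQR : Q = 0 ↔ R = 0) :
    (if a = P then (1 : ℝ) else 0) - (if Q = 1 ∧ R = 1 then (1 : ℝ) else 0) =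
      ((if (1 ≤ P + 1 ∧ P + 1 ≤ a) ∧ (P + 1 ≠ a ∨ Q = a) then -((P + 1 : ℕ) : ℝ) else 0)
        - (if 1 ≤ P ∧ P ≤ a then -(P : ℝ) else 0))
      - ((a : ℝ) - 1) * ((if Q = 0 then (1 : ℝ) else 0) - (if Q = 1 ∧ R = 1 then (1 : ℝ) else 0))
      + ((if 1 ≤ a - R ∧ a - R ≤ a - 1 then -((a - R : ℕ) : ℝ) else 0)
        - (if 1 ≤ a + 1 - R ∧ a + 1 - R ≤ a - 1 then -((a + 1 - R : ℕ) : ℝ) else 0))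
      + ((if (1 ≤ P + 1 ∧ P + 1 ≤ a - 1) ∧ R ≤ P + 1 then (a : ℝ) else 0)
        - (if (1 ≤ P ∧ P ≤ a - 1) ∧ R ≤ P + 1 ∧ 1 ≤ R ∧ (R ≠ 1 ∨ Q = 1) then (a : ℝ) else 0))
      + ((if (1 ≤ R ∧ R ≤ a - 1) ∧ a = P + 1 ∧ Q = a then (a : ℝ) else 0)
        - (if (1 ≤ R - 1 ∧ R - 1 ≤ a - 1) ∧ a = P then (a : ℝ) else 0))
      + ((if (1 ≤ P + 1 ∧ P + 1 ≤ a - 1) ∧ Q = P + 1 ∧ R = P + 1 then -(a : ℝ) else 0)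
        - (if (1 ≤ P ∧ P ≤ a - 1) ∧ Q = P + 1 ∧ R = P + 1 then -(a : ℝ) else 0)) := by
  have c1 : ((a - R : ℕ) : ℝ) = (a : ℝ) - R := by rw [Nat.cast_sub hR]
  have c2 : ((a + 1 - R : ℕ) : ℝ) = (a : ℝ) + 1 - R := by
    rw [Nat.cast_sub (by omega)]; push_cast; ring
  rw [c1, c2, Nat.cast_add, Nat.cast_one]
  have hPa : (P = 0 ∧ (P : ℝ) = 0) ∨ 1 ≤ P := by
    rcases Nat.eq_zero_or_pos P with h | h
    · left; exact ⟨h, by exact_mod_cast h⟩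
    · right; exact h
  have hPb : P + 1 < a ∨ (P + 1 = a ∧ (P : ℝ) + 1 = a) ∨ (P = a ∧ (P : ℝ) = a) := by
    rcases (by omega : P + 1 < a ∨ P + 1 = a ∨ P = a) with h | h | h
    · left; exact h
    · right; left; exact ⟨h, by exact_mod_cast h⟩
    · right; right; exact ⟨h, by exact_mod_cast h⟩
  have hRc : (R = 0 ∧ (R : ℝ) = 0) ∨ (R = 1 ∧ (R : ℝ) = 1) ∨ (2 ≤ R ∧ R < a) ∨
      (R = a ∧ (R : ℝ) = a) := by
    rcases (by omega : R = 0 ∨ R = 1 ∨ (2 ≤ R ∧ R < a) ∨ R = a) with h | h | h | h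
    · left; exact ⟨h, by exact_mod_cast h⟩
    · right; left; exact ⟨h, by exact_mod_cast h⟩
    · right; right; left; exact h
    · right; right; right; exact ⟨h, by exact_mod_cast h⟩
  clear c1 c2
  rcases hPb with h | ⟨h, hb⟩ | ⟨h, hb⟩ <;> rcases hPa with ⟨g, gg⟩ | g <;>
    rcases hRc with ⟨r, rr⟩ | ⟨r, rr⟩ | r | ⟨r, rr⟩ <;>
    (repeat' (first | (exfalso; omega) | split)) <;> linarith


/-- Theorem `peak minus valley for a,a,a`.
For `F = F̆(a,a,a)` (`t = 3`, peak `x_a`, valley `x_{2a}`):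
`χ_{x_a} − χ_{x_{2a}} = Σ_{i=1}^{a}(−i·T_{x_i}) − (a−1)·T_{x_{2a}} + Σ_{i=1}^{a−1}(−i·T_{x_{3a−i}})
 + Σ_{i=1}^{a−1}Σ_{j=0}^{i} a·T_{{x_i,x_{2a+j}}} + Σ_{j=1}^{a−1} a·T_{{x_a,x_{2a+j}}}
 + Σ_{i=1}^{a−1}(−a·T_{{x_i,x_{2a−i},x_{2a+i}}})`. -/
theorem statement10 (a : ℕ) (ha : 2 ≤ a) :
    ∀ I : J 3 (fun _ => a),
      chi 3 (fun _ => a) (xel 3 (fun _ => a) a) I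
          - chi 3 (fun _ => a) (xel 3 (fun _ => a) (2 * a)) I
        = (∑ i ∈ Finset.Icc 1 a,
            (-(i : ℝ)) * TA 3 (fun _ => a) {xel 3 (fun _ => a) i} I)
          - ((a : ℝ) - 1) * TA 3 (fun _ => a) {xel 3 (fun _ => a) (2 * a)} I
          + (∑ i ∈ Finset.Icc 1 (a - 1),
              (-(i : ℝ)) * TA 3 (fun _ => a) {xel 3 (fun _ => a) (3 * a - i)} I)
          + (∑ i ∈ Finset.Icc 1 (a - 1), ∑ j ∈ Finset.Icc 0 i,
              (a : ℝ) * TA 3 (fun _ => a)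
                {xel 3 (fun _ => a) i, xel 3 (fun _ => a) (2 * a + j)} I)
          + (∑ j ∈ Finset.Icc 1 (a - 1),
              (a : ℝ) * TA 3 (fun _ => a)
                {xel 3 (fun _ => a) a, xel 3 (fun _ => a) (2 * a + j)} I)
          + (∑ i ∈ Finset.Icc 1 (a - 1),
              (-(a : ℝ)) * TA 3 (fun _ => a)
                {xel 3 (fun _ => a) i, xel 3 (fun _ => a) (2 * a - i),
                  xel 3 (fun _ => a) (2 * a + i)} I) := by
  intro I
  obtain ⟨P, Q, R, hP, hQ, hR, hPQ, hQR, e1, e2, e3⟩ := params ha I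
  -- toggleability of each element in terms of the cuts
  have mn1 : ∀ i, 1 ≤ i → i < a →
      (MinOut 3 (fun _ => a) I.1 (xel 3 (fun _ => a) i) ↔ i = P + 1) := by
    intro i h1 h2
    rw [minOut_xel I h1 (by omega), e1 i (by omega) (by omega)]
    by_cases hi : 1 < i
    · rw [e1 (i - 1) (by omega) (by omega)]; omega
    · omega
  have mx1 : ∀ i, 1 ≤ i → i < a →
      (MaxIn 3 (fun _ => a) I.1 (xel 3 (fun _ => a) i) ↔ i = P) := by
    intro i h1 h2
    rw [maxIn_xel I h1 (by omega), e1 i (by omega) (by omega), e1 (i + 1) (by omega) (by omega)]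
    omega
  have mna : MinOut 3 (fun _ => a) I.1 (xel 3 (fun _ => a) a) ↔ a = P + 1 ∧ Q = a := by
    rw [minOut_xel I (by omega) (by omega), e1 a (by omega) (by omega),
      e1 (a - 1) (by omega) (by omega), e2 (a + 1) (by omega) (by omega)]
    omega
  have mxa : MaxIn 3 (fun _ => a) I.1 (xel 3 (fun _ => a) a) ↔ a = P := by
    rw [maxIn_xel I (by omega) (by omega), e1 a (by omega) (by omega)]
    omega
  have mn2 : ∀ i, 1 ≤ i → i < a →
      (MinOut 3 (fun _ => a) I.1 (xel 3 (fun _ => a) (2 * a - i)) ↔ i = Q) := by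
    intro i h1 h2
    rw [minOut_xel I (by omega) (by omega), e2 (2 * a - i) (by omega) (by omega),
      e2 (2 * a - i + 1) (by omega) (by omega)]
    omega
  have mx2 : ∀ i, 1 ≤ i → i < a →
      (MaxIn 3 (fun _ => a) I.1 (xel 3 (fun _ => a) (2 * a - i)) ↔ i + 1 = Q ∧ P < a) := by
    intro i h1 h2
    rw [maxIn_xel I (by omega) (by omega), e2 (2 * a - i) (by omega) (by omega)]
    by_cases hi : i + 1 < a
    · rw [e2 (2 * a - i - 1) (by omega) (by omega)]; omega
    · rw [e1 (2 * a - i - 1) (by omega) (by omega)]; omega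
  have mnv : MinOut 3 (fun _ => a) I.1 (xel 3 (fun _ => a) (2 * a)) ↔ Q = 0 := by
    rw [minOut_xel I (by omega) (by omega), e2 (2 * a) (by omega) (by omega)]
    omega
  have mxv : MaxIn 3 (fun _ => a) I.1 (xel 3 (fun _ => a) (2 * a)) ↔ Q = 1 ∧ R = 1 := by
    rw [maxIn_xel I (by omega) (by omega), e2 (2 * a) (by omega) (by omega),
      e3 (2 * a + 1) (by omega) (by omega), e2 (2 * a - 1) (by omega) (by omega)]
    omega
  have mn3 : ∀ j, 1 ≤ j → j < a →
      (MinOut 3 (fun _ => a) I.1 (xel 3 (fun _ => a) (2 * a + j)) ↔ j = R) := by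
    intro j h1 h2
    rw [minOut_xel I (by omega) (by omega), e3 (2 * a + j) (by omega) (by omega),
      e3 (2 * a + j - 1) (by omega) (by omega)]
    omega
  have mx3 : ∀ j, 1 ≤ j → j < a →
      (MaxIn 3 (fun _ => a) I.1 (xel 3 (fun _ => a) (2 * a + j)) ↔ j + 1 = R) := by
    intro j h1 h2
    rw [maxIn_xel I (by omega) (by omega), e3 (2 * a + j) (by omega) (by omega)]
    by_cases hj : j + 1 < a
    · rw [e3 (2 * a + j + 1) (by omega) (by omega)]; omega
    · omega
  -- the six sums
  have s1 := sum_TA I (Finset.Icc 1 a) (fun i => -(i : ℝ)) (fun i => {xel 3 (fun _ => a) i})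
    (fun i => Set.singleton_nonempty _) (P + 1) P (P + 1 ≠ a ∨ Q = a) True
    (by
      intro i hi
      rw [Finset.mem_Icc] at hi
      simp only [Set.mem_singleton_iff, forall_eq]
      by_cases h : i = a
      · subst h; rw [mna]; omega
      · rw [mn1 i (by omega) (by omega)]; omega)
    (by
      intro i hi
      rw [Finset.mem_Icc] at hi
      simp only [Set.mem_singleton_iff, forall_eq]
      by_cases h : i = a
      · subst h; rw [mxa, and_true]
      · rw [mx1 i (by omega) (by omega), and_true])
  have s2 := TA_eq {xel 3 (fun _ => a) (2 * a)} (Set.singleton_nonempty _) I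
  simp only [Set.mem_singleton_iff, forall_eq, mnv, mxv] at s2
  have s3 := sum_TA I (Finset.Icc 1 (a - 1)) (fun i => -(i : ℝ))
    (fun i => {xel 3 (fun _ => a) (3 * a - i)})
    (fun i => Set.singleton_nonempty _) (a - R) (a + 1 - R) True True
    (by
      intro i hi
      rw [Finset.mem_Icc] at hi
      simp only [Set.mem_singleton_iff, forall_eq]
      rw [show 3 * a - i = 2 * a + (a - i) by omega, mn3 _ (by omega) (by omega), and_true]
      omega)
    (by
      intro i hi
      rw [Finset.mem_Icc] at hi
      simp only [Set.mem_singleton_iff, forall_eq]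
      rw [show 3 * a - i = 2 * a + (a - i) by omega, mx3 _ (by omega) (by omega), and_true]
      omega)
  have s4in : ∀ i ∈ Finset.Icc 1 (a - 1), ∑ j ∈ Finset.Icc 0 i,
              (a : ℝ) * TA 3 (fun _ => a)
                {xel 3 (fun _ => a) i, xel 3 (fun _ => a) (2 * a + j)} I
      = (a : ℝ) * (if R ≤ i ∧ i = P + 1 then (1 : ℝ) else 0)
        - (a : ℝ) * (if R - 1 ≤ i ∧ i = P ∧ 1 ≤ R ∧ (R ≠ 1 ∨ Q = 1) then (1 : ℝ) else 0) := by
    intro i hi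
    rw [Finset.mem_Icc] at hi
    rw [sum_TA I (Finset.Icc 0 i) (fun _ => (a : ℝ))
      (fun j => {xel 3 (fun _ => a) i, xel 3 (fun _ => a) (2 * a + j)})
      (fun j => Set.insert_nonempty _ _) R (R - 1) (i = P + 1)
      (i = P ∧ 1 ≤ R ∧ (R ≠ 1 ∨ Q = 1))]
    · simp [Finset.mem_Icc]
    · intro j hj
      rw [Finset.mem_Icc] at hj
      simp only [Set.mem_insert_iff, Set.mem_singleton_iff, forall_eq_or_imp, forall_eq]
      rw [mn1 i (by omega) (by omega)]
      by_cases h : j = 0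
      · subst h; rw [show 2 * a + 0 = 2 * a from rfl, mnv]; omega
      · rw [mn3 j (by omega) (by omega)]; omega
    · intro j hj
      rw [Finset.mem_Icc] at hj
      simp only [Set.mem_insert_iff, Set.mem_singleton_iff, forall_eq_or_imp, forall_eq]
      rw [mx1 i (by omega) (by omega)]
      by_cases h : j = 0
      · subst h; rw [show 2 * a + 0 = 2 * a from rfl, mxv]; omega
      · rw [mx3 j (by omega) (by omega)]; omega
  have s4 := Finset.sum_congr rfl s4in
  rw [Finset.sum_sub_distrib,
    sum_pick (Finset.Icc 1 (a - 1)) (fun _ => (a : ℝ)) (fun i => R ≤ i ∧ i = P + 1) (P + 1) (R ≤ P + 1)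
      (by intro i _; omega),
    sum_pick (Finset.Icc 1 (a - 1)) (fun _ => (a : ℝ))
      (fun i => R - 1 ≤ i ∧ i = P ∧ 1 ≤ R ∧ (R ≠ 1 ∨ Q = 1)) P
      (R ≤ P + 1 ∧ 1 ≤ R ∧ (R ≠ 1 ∨ Q = 1))
      (by intro i _; omega)] at s4
  have s5 := sum_TA I (Finset.Icc 1 (a - 1)) (fun _ => (a : ℝ))
    (fun j => {xel 3 (fun _ => a) a, xel 3 (fun _ => a) (2 * a + j)})
    (fun j => Set.insert_nonempty _ _) R (R - 1) (a = P + 1 ∧ Q = a) (a = P)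
    (by
      intro j hj
      rw [Finset.mem_Icc] at hj
      simp only [Set.mem_insert_iff, Set.mem_singleton_iff, forall_eq_or_imp, forall_eq]
      rw [mna, mn3 j (by omega) (by omega)]; omega)
    (by
      intro j hj
      rw [Finset.mem_Icc] at hj
      simp only [Set.mem_insert_iff, Set.mem_singleton_iff, forall_eq_or_imp, forall_eq]
      rw [mxa, mx3 j (by omega) (by omega)]; omega)
  have s6 := sum_TA I (Finset.Icc 1 (a - 1)) (fun _ => -(a : ℝ))
    (fun i => {xel 3 (fun _ => a) i, xel 3 (fun _ => a) (2 * a - i),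
                  xel 3 (fun _ => a) (2 * a + i)})
    (fun j => Set.insert_nonempty _ _) (P + 1) P (Q = P + 1 ∧ R = P + 1)
    (Q = P + 1 ∧ R = P + 1)
    (by
      intro j hj
      rw [Finset.mem_Icc] at hj
      simp only [Set.mem_insert_iff, Set.mem_singleton_iff, forall_eq_or_imp, forall_eq]
      rw [mn1 j (by omega) (by omega), mn2 j (by omega) (by omega), mn3 j (by omega) (by omega)]
      omega)
    (by
      intro j hj
      rw [Finset.mem_Icc] at hj
      simp only [Set.mem_insert_iff, Set.mem_singleton_iff, forall_eq_or_imp, forall_eq]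
      rw [mx1 j (by omega) (by omega), mx2 j (by omega) (by omega), mx3 j (by omega) (by omega)]
      omega)
  rw [s1, s2, s3, s4, s5, s6]
  unfold chi
  simp only [mxa, mxv, Finset.mem_Icc, and_true]
  exact arith_id a P Q R ha hP hQ hR hPQ hQR

end Fence
end
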